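/- arXiv:1005.2010 — 3 statements merged into one kernel-verified Lean document; each statement's English description precedes it below -/
import Mathlib

section
/- Let X be a smooth vector field on an open ball U ⊆ ℝ³ with curl X = 0. Then there exists a smooth function f on U with X = grad f. -/
open scoped BigOperators

/-- Partial derivative in the `i`-th coordinate direction on `ℝ³`. -/
noncomputable def pd (i : Fin 3) (f : (Fin 3 → ℝ) → ℝ) (x : Fin 3 → ℝ) : ℝ :=
  fderiv ℝ f x (Pi.single i 1)

/-- The Levi-Civita symbol on `ℝ³` with `eps 0 1 2 = 1`. -/
noncomputable def eps (i j k : Fin 3) : ℝ :=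
  (((j : ℕ) : ℝ) - ((i : ℕ) : ℝ)) * (((k : ℕ) : ℝ) - ((i : ℕ) : ℝ)) *
    (((k : ℕ) : ℝ) - ((j : ℕ) : ℝ)) / 2

/-- A function on an open set whose derivative is a smooth `1`-form is itself smooth. -/
theorem contDiffOn_infty_of_hasFDerivAt {E F : Type*} [NormedAddCommGroup E] [NormedSpace ℝ E]
    [NormedAddCommGroup F] [NormedSpace ℝ F] {s : Set E} (hs : IsOpen s) {f : E → F}
    {ω : E → E →L[ℝ] F} (hω : ContDiffOn ℝ (⊤ : ℕ∞) ω s) (hf : ∀ x ∈ s, HasFDerivAt f (ω x) x) :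
    ContDiffOn ℝ (⊤ : ℕ∞) f s :=
  (contDiffOn_infty_iff_fderiv_of_isOpen hs).2
    ⟨fun x hx ↦ (hf x hx).differentiableAt.differentiableWithinAt,
      hω.congr fun x hx ↦ (hf x hx).fderiv⟩

theorem fderiv_apply_eq_sum_pd (f : (Fin 3 → ℝ) → ℝ) (x u : Fin 3 → ℝ) :
    fderiv ℝ f x u = ∑ j, u j * pd j f x := by
  conv_lhs => rw [pi_eq_sum_univ' u]
  simp [pd]

/-- The mixed partial derivatives of a curl-free vector field agree. -/
theorem pd_comm_of_curl_eq_zero {X : Fin 3 → (Fin 3 → ℝ) → ℝ} {x : Fin 3 → ℝ}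
    (h : ∀ i, ∑ j, ∑ k, eps i j k * pd j (X k) x = 0) (j k : Fin 3) :
    pd j (X k) x = pd k (X j) x := by
  have h0 := h 0
  have h1 := h 1
  have h2 := h 2
  simp only [Fin.sum_univ_three, eps] at h0 h1 h2
  norm_num at h0 h1 h2
  fin_cases j <;> fin_cases k <;> simp <;> linarith

/-- The `1`-form `∑ k, X k dx_k` associated with a vector field `X`. -/
noncomputable def oneForm (X : Fin 3 → (Fin 3 → ℝ) → ℝ) (x : Fin 3 → ℝ) :
    (Fin 3 → ℝ) →L[ℝ] ℝ :=
  ∑ k, X k x • ContinuousLinearMap.proj k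

theorem oneForm_apply (X : Fin 3 → (Fin 3 → ℝ) → ℝ) (x v : Fin 3 → ℝ) :
    oneForm X x v = ∑ k, X k x * v k := by
  simp [oneForm]

theorem fderiv_oneForm_apply {X : Fin 3 → (Fin 3 → ℝ) → ℝ} {x : Fin 3 → ℝ}
    (hX : ∀ k, DifferentiableAt ℝ (X k) x) (u v : Fin 3 → ℝ) :
    fderiv ℝ (oneForm X) x u v = ∑ k, ∑ j, u j * pd j (X k) x * v k := by
  have h : HasFDerivAt (oneForm X)
      (∑ k, (fderiv ℝ (X k) x).smulRight
        (ContinuousLinearMap.proj k : (Fin 3 → ℝ) →L[ℝ] ℝ)) x :=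
    HasFDerivAt.fun_sum fun k _ ↦ (hX k).hasFDerivAt.smul_const
      (ContinuousLinearMap.proj k : (Fin 3 → ℝ) →L[ℝ] ℝ)
  simp [h.fderiv, fderiv_apply_eq_sum_pd, Finset.sum_mul]

/-- Poincaré lemma for curl on a ball in ℝ³: a curl-free smooth vector field is a gradient. -/
theorem curlFree_is_grad (c : Fin 3 → ℝ) (r : ℝ)
    (X : Fin 3 → (Fin 3 → ℝ) → ℝ)
    (hX : ∀ i, ContDiffOn ℝ (⊤ : ℕ∞) (X i) (Metric.ball c r))
    (hcurl : ∀ i, ∀ x ∈ Metric.ball c r, ∑ j, ∑ k, eps i j k * pd j (X k) x = 0) :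
    ∃ f : (Fin 3 → ℝ) → ℝ, ContDiffOn ℝ (⊤ : ℕ∞) f (Metric.ball c r) ∧
      ∀ i, ∀ x ∈ Metric.ball c r, X i x = pd i f x := by
  have hω : ContDiffOn ℝ (⊤ : ℕ∞) (oneForm X) (Metric.ball c r) :=
    ContDiffOn.sum fun k _ ↦ (hX k).smul contDiffOn_const
  obtain ⟨f, hf⟩ := (convex_ball c r).exists_forall_hasFDerivAt_of_fderiv_symmetric
    Metric.isOpen_ball (hω.differentiableOn (by simp)) fun a ha u v ↦ by
      have hd (k) : DifferentiableAt ℝ (X k) a :=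
        ((hX k).differentiableOn (by simp)).differentiableAt (Metric.isOpen_ball.mem_nhds ha)
      rw [fderiv_oneForm_apply hd, fderiv_oneForm_apply hd, Finset.sum_comm]
      refine Finset.sum_congr rfl fun j _ ↦ Finset.sum_congr rfl fun k _ ↦ ?_
      rw [pd_comm_of_curl_eq_zero (fun i ↦ hcurl i a ha) j k]
      ring
  refine ⟨f, contDiffOn_infty_of_hasFDerivAt Metric.isOpen_ball hω hf, fun i x hx ↦ ?_⟩
  simp [pd, (hf x hx).fderiv, oneForm_apply, Pi.single_apply]
end

section
/- Let Σ be a smooth symmetric 2-tensor field on an open ball U ⊆ ℝ³ satisfying the Saint-Venant equations curl curl Σ = 0. Then there exists a smooth vector field X on U such that Σᵢⱼ = ½(∂ᵢXⱼ + ∂ⱼXᵢ). -/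
open scoped BigOperators

open scoped ContDiff in
theorem contDiffOn_pd {s : Set (Fin 3 → ℝ)} (hs : IsOpen s) {f : (Fin 3 → ℝ) → ℝ}
    (hf : ContDiffOn ℝ ∞ f s) (i : Fin 3) : ContDiffOn ℝ ∞ (pd i f) s :=
  ((contDiffOn_infty_iff_fderiv_of_isOpen hs).1 hf).2.clm_apply contDiffOn_const

theorem pd_add {f g : (Fin 3 → ℝ) → ℝ} {x : Fin 3 → ℝ} (hf : DifferentiableAt ℝ f x)
    (hg : DifferentiableAt ℝ g x) (i : Fin 3) :
    pd i (fun y => f y + g y) x = pd i f x + pd i g x := by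
  simp [pd, fderiv_fun_add hf hg]

theorem pd_sub {f g : (Fin 3 → ℝ) → ℝ} {x : Fin 3 → ℝ} (hf : DifferentiableAt ℝ f x)
    (hg : DifferentiableAt ℝ g x) (i : Fin 3) :
    pd i (fun y => f y - g y) x = pd i f x - pd i g x := by
  simp [pd, fderiv_fun_sub hf hg]

theorem pd_const_mul {f : (Fin 3 → ℝ) → ℝ} {x : Fin 3 → ℝ} (hf : DifferentiableAt ℝ f x)
    (a : ℝ) (i : Fin 3) : pd i (fun y => a * f y) x = a * pd i f x := by
  simp [pd, fderiv_const_mul hf]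

open scoped ContDiff in
theorem pd_comm {s : Set (Fin 3 → ℝ)} (hs : IsOpen s) {f : (Fin 3 → ℝ) → ℝ}
    (hf : ContDiffOn ℝ ∞ f s) {x : Fin 3 → ℝ} (hx : x ∈ s) (i j : Fin 3) :
    pd i (pd j f) x = pd j (pd i f) x := by
  have hd : DifferentiableAt ℝ (fderiv ℝ f) x :=
    (((contDiffOn_infty_iff_fderiv_of_isOpen hs).1 hf).2.contDiffAt
      (hs.mem_nhds hx)).differentiableAt (by simp)
  have hpd (k l : Fin 3) : pd k (pd l f) x =
      fderiv ℝ (fderiv ℝ f) x (Pi.single k 1) (Pi.single l 1) := by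
    change fderiv ℝ (fun y => fderiv ℝ f y (Pi.single l 1)) x (Pi.single k 1) = _
    rw [fderiv_clm_apply hd (differentiableAt_const _)]
    simp
  have hsymm : IsSymmSndFDerivAt ℝ f x :=
    (hf.contDiffAt (hs.mem_nhds hx)).isSymmSndFDerivAt
      (by simpa using ENat.LEInfty.out)
  rw [hpd, hpd, hsymm.eq]

open scoped ContDiff in
/-- Poincaré lemma for one-forms on a convex open subset of `ℝ³`, in coordinates. -/
theorem exists_pd_eq_of_closed {s : Set (Fin 3 → ℝ)} (hs : IsOpen s) (hsc : Convex ℝ s)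
    {w : Fin 3 → (Fin 3 → ℝ) → ℝ} (hw : ∀ i, ContDiffOn ℝ ∞ (w i) s)
    (hclosed : ∀ i j, ∀ x ∈ s, pd i (w j) x = pd j (w i) x) :
    ∃ f, ContDiffOn ℝ ∞ f s ∧ ∀ i, ∀ x ∈ s, pd i f x = w i x := by
  let form : (Fin 3 → ℝ) → (Fin 3 → ℝ) →L[ℝ] ℝ :=
    fun x => ∑ i, w i x • ContinuousLinearMap.proj (R := ℝ) (φ := fun _ : Fin 3 => ℝ) i
  have hform : ContDiffOn ℝ ∞ form s :=
    ContDiffOn.sum fun i _ => (hw i).smul contDiffOn_const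
  have hdiff (i : Fin 3) {x} (hx : x ∈ s) : DifferentiableAt ℝ (w i) x :=
    ((hw i).contDiffAt (hs.mem_nhds hx)).differentiableAt (by simp)
  have hfderiv {x} (hx : x ∈ s) (u v : Fin 3 → ℝ) :
      fderiv ℝ form x u v = ∑ i, ∑ j, u i * v j * pd i (w j) x := by
    have hder : HasFDerivAt form (∑ j, (fderiv ℝ (w j) x).smulRight
        (ContinuousLinearMap.proj (R := ℝ) (φ := fun _ : Fin 3 => ℝ) j)) x :=
      HasFDerivAt.fun_sum fun j _ => (hdiff j hx).hasFDerivAt.smul_const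
        (ContinuousLinearMap.proj (R := ℝ) (φ := fun _ : Fin 3 => ℝ) j)
    have hlin (j : Fin 3) : fderiv ℝ (w j) x u = ∑ i, u i * pd i (w j) x := by
      conv_lhs => rw [pi_eq_sum_univ' u]
      simp [pd]
    rw [hder.fderiv, Finset.sum_comm]
    simp [hlin, Finset.sum_mul, mul_right_comm]
  obtain ⟨f, hf⟩ := hsc.exists_forall_hasFDerivAt_of_fderiv_symmetric hs
    (hform.differentiableOn (by simp)) fun x hx u v => by
      rw [hfderiv hx, hfderiv hx, Finset.sum_comm]
      refine Finset.sum_congr rfl fun i _ => Finset.sum_congr rfl fun j _ => ?_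
      rw [hclosed i j x hx, mul_comm (u j)]
  refine ⟨f, (contDiffOn_infty_iff_fderiv_of_isOpen hs).2
    ⟨fun x hx => (hf x hx).differentiableAt.differentiableWithinAt,
      hform.congr fun x hx => (hf x hx).fderiv⟩, fun i x hx => ?_⟩
  simp [pd, (hf x hx).fderiv, form, Pi.single_apply]

/-- The vanishing of the double curl forces the linearized Riemann tensor to vanish. -/
theorem riemann_eq_zero_of_curl_curl_eq_zero {D : Fin 3 → Fin 3 → Fin 3 → Fin 3 → ℝ}
    (hD : ∀ k l m n, D k l m n = D l k m n) (hD' : ∀ k l m n, D k l m n = D k l n m)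
    (h : ∀ i j, ∑ k, ∑ m, ∑ l, ∑ n, eps i k m * eps j l n * D k l m n = 0)
    (i j k l : Fin 3) : D l j i k - D l i j k = D k j i l - D k i j l := by
  have h00 := h 0 0
  have h01 := h 0 1
  have h02 := h 0 2
  have h11 := h 1 1
  have h12 := h 1 2
  have h22 := h 2 2
  simp only [Fin.sum_univ_three, eps] at h00 h01 h02 h11 h12 h22
  norm_num at h00 h01 h02 h11 h12 h22
  have a10 := hD 1 0
  have a20 := hD 2 0
  have a21 := hD 2 1
  have b10 := fun k l => hD' k l 1 0
  have b20 := fun k l => hD' k l 2 0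
  have b21 := fun k l => hD' k l 2 1
  simp only [a10, a20, a21, b10, b20, b21] at h00 h01 h02 h11 h12 h22
  fin_cases i <;> fin_cases j <;> fin_cases k <;> fin_cases l <;> simp <;>
    (try simp only [a10, a20, a21, b10, b20, b21]) <;> linarith

/-- Converse Saint-Venant: on a ball, a smooth symmetric tensor with
`curl curl Σ = 0` is a symmetrized gradient. -/
theorem saintVenant_is_symGrad (c : Fin 3 → ℝ) (r : ℝ)
    (S : Fin 3 → Fin 3 → (Fin 3 → ℝ) → ℝ)
    (hSsmooth : ∀ i j, ContDiffOn ℝ (⊤ : ℕ∞) (S i j) (Metric.ball c r))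
    (hSsym : ∀ i j x, S i j x = S j i x)
    (hSV : ∀ i j, ∀ x ∈ Metric.ball c r,
      ∑ k, ∑ m, ∑ l, ∑ n, eps i k m * eps j l n * pd k (fun y => pd l (S m n) y) x = 0) :
    ∃ X : Fin 3 → (Fin 3 → ℝ) → ℝ,
      (∀ i, ContDiffOn ℝ (⊤ : ℕ∞) (X i) (Metric.ball c r)) ∧
      ∀ i j, ∀ x ∈ Metric.ball c r, S i j x = (pd i (X j) x + pd j (X i) x) / 2 := by
  have hs : IsOpen (Metric.ball c r) := Metric.isOpen_ball
  have hsc : Convex ℝ (Metric.ball c r) := convex_ball c r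
  have hdiff {f : (Fin 3 → ℝ) → ℝ} (hf : ContDiffOn ℝ (⊤ : ℕ∞) f (Metric.ball c r)) {x}
      (hx : x ∈ Metric.ball c r) : DifferentiableAt ℝ f x :=
    (hf.contDiffAt (hs.mem_nhds hx)).differentiableAt (by simp)
  have hsymm (i j : Fin 3) : S i j = S j i := funext (hSsym i j)
  have hpd (i j k : Fin 3) : ContDiffOn ℝ (⊤ : ℕ∞) (pd i (S j k)) (Metric.ball c r) :=
    contDiffOn_pd hs (hSsmooth j k) i
  have hrot (i j : Fin 3) : ∃ W, ContDiffOn ℝ (⊤ : ℕ∞) W (Metric.ball c r) ∧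
      ∀ k, ∀ x ∈ Metric.ball c r, pd k W x = pd j (S i k) x - pd i (S j k) x := by
    refine exists_pd_eq_of_closed hs hsc (fun k => (hpd j i k).sub (hpd i j k))
      fun l k x hx => ?_
    rw [pd_sub (hdiff (hpd j i k) hx) (hdiff (hpd i j k) hx),
      pd_sub (hdiff (hpd j i l) hx) (hdiff (hpd i j l) hx)]
    exact riemann_eq_zero_of_curl_curl_eq_zero (D := fun k l m n => pd k (pd l (S m n)) x)
      (fun k l m n => pd_comm hs (hSsmooth m n) hx k l)
      (fun k l m n => by rw [hsymm m n]) (fun i j => hSV i j x hx) i j k l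
  choose W hW hWpd using hrot
  have hgrad (i : Fin 3) : ∃ X, ContDiffOn ℝ (⊤ : ℕ∞) X (Metric.ball c r) ∧
      ∀ j, ∀ x ∈ Metric.ball c r, pd j X x = S i j x + 1 / 2 * (W i j x - W j i x) := by
    have hA (j : Fin 3) : ContDiffOn ℝ (⊤ : ℕ∞) (fun y => W i j y - W j i y)
        (Metric.ball c r) := (hW i j).sub (hW j i)
    have hB (j : Fin 3) : ContDiffOn ℝ (⊤ : ℕ∞) (fun y => 1 / 2 * (W i j y - W j i y))
        (Metric.ball c r) := contDiffOn_const.mul (hA j)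
    refine exists_pd_eq_of_closed hs hsc (fun j => (hSsmooth i j).add (hB j))
      fun k j x hx => ?_
    have hexpand (k j : Fin 3) : pd k (fun y => S i j y + 1 / 2 * (W i j y - W j i y)) x =
        pd k (S i j) x + (pd j (S i k) x - pd i (S j k) x) := by
      rw [pd_add (hdiff (hSsmooth i j) hx) (hdiff (hB j) hx), pd_const_mul (hdiff (hA j) hx),
        pd_sub (hdiff (hW i j) hx) (hdiff (hW j i) hx), hWpd i j k x hx, hWpd j i k x hx]
      ring
    rw [hexpand, hexpand, hsymm j k]
    ring
  choose X hX hXpd using hgrad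
  refine ⟨X, hX, fun i j x hx => ?_⟩
  rw [hXpd j i x hx, hXpd i j x hx, hSsym j i x]
  ring
end

section
/- Let U ⊆ ℝ³ be an open ball and suppose the pair of tensor fields (Σ, Ξ) satisfies curl(Σ, Ξ) = 0, where curl(Σ, Ξ) = (εᵢʲᵏ ∂ⱼΣₖₗ − Ξₗᵢ + δᵢₗ Ξₘᵐ, εᵢʲᵏ ∂ⱼΞₖₗ). Then there exist smooth vector fields X, Y on U with ∂ⱼXₗ − εⱼₗᵐ Yₘ = Σⱼₗ and ∂ⱼYₗ = Ξⱼₗ. -/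
open scoped BigOperators

/-- A smooth closed `1`-form `∑ j, F j dxʲ` on an open convex set of `ℝ³` is the gradient of a
smooth function. -/
theorem exists_contDiffOn_pd_eq {s : Set (Fin 3 → ℝ)} (hs : Convex ℝ s) (hso : IsOpen s)
    {F : Fin 3 → (Fin 3 → ℝ) → ℝ} (hF : ∀ j, ContDiffOn ℝ (⊤ : ℕ∞) (F j) s)
    (hclosed : ∀ i j, ∀ x ∈ s, pd i (F j) x = pd j (F i) x) :
    ∃ f : (Fin 3 → ℝ) → ℝ, ContDiffOn ℝ (⊤ : ℕ∞) f s ∧ ∀ j, ∀ x ∈ s, pd j f x = F j x := by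
  let proj : Fin 3 → (Fin 3 → ℝ) →L[ℝ] ℝ := fun j => ContinuousLinearMap.proj j
  let ω : (Fin 3 → ℝ) → (Fin 3 → ℝ) →L[ℝ] ℝ := fun x => ∑ j, F j x • proj j
  have hω : ContDiffOn ℝ (⊤ : ℕ∞) ω s :=
    ContDiffOn.sum fun j _ => (hF j).smul contDiffOn_const
  have hdω : ∀ a ∈ s, HasFDerivAt ω (∑ j, (fderiv ℝ (F j) a).smulRight (proj j)) a :=
    fun a ha => HasFDerivAt.fun_sum fun j _ =>
      ((((hF j).differentiableOn (by simp)).differentiableAt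
        (hso.mem_nhds ha)).hasFDerivAt).smul_const (proj j)
  have hexpand : ∀ (L : (Fin 3 → ℝ) →L[ℝ] ℝ) (v : Fin 3 → ℝ),
      L v = ∑ i, v i * L (Pi.single i 1) := fun L v => by
    conv_lhs => rw [pi_eq_sum_univ' v]
    simp [map_sum]
  obtain ⟨f, hf⟩ := hs.exists_forall_hasFDerivAt_of_fderiv_symmetric hso
    (hω.differentiableOn (by simp)) (fun a ha u v => by
      have h₀₁ := hclosed 0 1 a ha
      have h₀₂ := hclosed 0 2 a ha
      have h₁₂ := hclosed 1 2 a ha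
      simp only [pd] at h₀₁ h₀₂ h₁₂
      rw [(hdω a ha).fderiv]
      simp only [sum_apply, ContinuousLinearMap.smulRight_apply, proj,
        smul_apply, ContinuousLinearMap.proj_apply, smul_eq_mul]
      simp only [hexpand (fderiv ℝ (F _) a) u, hexpand (fderiv ℝ (F _) a) v, Fin.sum_univ_three,
        h₀₁, h₀₂, h₁₂]
      ring)
  refine ⟨f, (contDiffOn_infty_iff_fderiv_of_isOpen hso).2
    ⟨fun a ha => (hf a ha).differentiableAt.differentiableWithinAt,
      hω.congr fun a ha => (hf a ha).fderiv⟩, fun j x hx => ?_⟩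
  simp [pd, (hf x hx).fderiv, ω, proj, Pi.single_apply]

/-- Poincaré lemma for the flat connection: on a ball, a pair `(Σ, Ξ)` with vanishing
coupled curl is the modified gradient of a pair of vector fields `(X, Y)`. -/
theorem coupled_poincare (c : Fin 3 → ℝ) (r : ℝ)
    (S Xi : Fin 3 → Fin 3 → (Fin 3 → ℝ) → ℝ)
    (hSsmooth : ∀ i j, ContDiffOn ℝ (⊤ : ℕ∞) (S i j) (Metric.ball c r))
    (hXismooth : ∀ i j, ContDiffOn ℝ (⊤ : ℕ∞) (Xi i j) (Metric.ball c r))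
    (hcurl : ∀ i l, ∀ x ∈ Metric.ball c r,
      ((∑ j, ∑ k, eps i j k * pd j (S k l) x) - Xi l i x
        + (if i = l then ∑ m, Xi m m x else 0) = 0) ∧
      (∑ j, ∑ k, eps i j k * pd j (Xi k l) x = 0)) :
    ∃ X Y : Fin 3 → (Fin 3 → ℝ) → ℝ,
      (∀ i, ContDiffOn ℝ (⊤ : ℕ∞) (X i) (Metric.ball c r)) ∧
      (∀ i, ContDiffOn ℝ (⊤ : ℕ∞) (Y i) (Metric.ball c r)) ∧
      ∀ j l, ∀ x ∈ Metric.ball c r,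
        pd j (X l) x - (∑ m, eps j l m * Y m x) = S j l x ∧ pd j (Y l) x = Xi j l x := by
  have hconv : Convex ℝ (Metric.ball c r) := convex_ball c r
  have hopen : IsOpen (Metric.ball c r) := Metric.isOpen_ball
  have hdiff : ∀ {f : (Fin 3 → ℝ) → ℝ}, ContDiffOn ℝ (⊤ : ℕ∞) f (Metric.ball c r) →
      ∀ x ∈ Metric.ball c r, DifferentiableAt ℝ f x := fun hf x hx =>
    (hf.differentiableOn (by simp)).differentiableAt (hopen.mem_nhds hx)
  have hY : ∀ l, ∃ f : (Fin 3 → ℝ) → ℝ, ContDiffOn ℝ (⊤ : ℕ∞) f (Metric.ball c r) ∧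
      ∀ j, ∀ x ∈ Metric.ball c r, pd j f x = Xi j l x := fun l => by
    refine exists_contDiffOn_pd_eq hconv hopen (fun j => hXismooth j l) fun i j x hx => ?_
    have h₀ := (hcurl 0 l x hx).2
    have h₁ := (hcurl 1 l x hx).2
    have h₂ := (hcurl 2 l x hx).2
    simp [Fin.sum_univ_three, eps] at h₀ h₁ h₂
    fin_cases i <;> fin_cases j <;> simp <;> linarith
  choose Y hYsmooth hYgrad using hY
  have hX : ∀ l, ∃ f : (Fin 3 → ℝ) → ℝ, ContDiffOn ℝ (⊤ : ℕ∞) f (Metric.ball c r) ∧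
      ∀ j, ∀ x ∈ Metric.ball c r, pd j f x = S j l x + ∑ m, eps j l m * Y m x := fun l => by
    refine exists_contDiffOn_pd_eq hconv hopen
      (F := fun j x => S j l x + ∑ m, eps j l m * Y m x)
      (fun j => (hSsmooth j l).add
        (ContDiffOn.sum fun m _ => contDiffOn_const.mul (hYsmooth m))) fun i j x hx => ?_
    have hpd : ∀ i j, pd i (fun x => S j l x + ∑ m, eps j l m * Y m x) x =
        pd i (S j l) x + ∑ m, eps j l m * Xi i m x := fun i j => by
      have h := (hdiff (hSsmooth j l) x hx).hasFDerivAt.add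
        (HasFDerivAt.fun_sum fun m (_ : m ∈ Finset.univ) =>
          (hdiff (hYsmooth m) x hx).hasFDerivAt.const_mul (eps j l m))
      have h' : fderiv ℝ (fun x => S j l x + ∑ m, eps j l m * Y m x) x = _ := h.fderiv
      simp only [pd, h', ← hYgrad _ _ x hx]
      simp
    rw [hpd, hpd]
    have h₀ := (hcurl 0 l x hx).1
    have h₁ := (hcurl 1 l x hx).1
    have h₂ := (hcurl 2 l x hx).1
    simp only [Fin.sum_univ_three, eps] at h₀ h₁ h₂ ⊢
    fin_cases l <;> simp at h₀ h₁ h₂ <;> fin_cases i <;> fin_cases j <;> simp <;> linarith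
  choose X hXsmooth hXgrad using hX
  exact ⟨X, Y, hXsmooth, hYsmooth, fun j l x hx =>
    ⟨by rw [hXgrad l j x hx, add_sub_cancel_right], hYgrad l j x hx⟩⟩
end
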